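/- For every integer h ≥ 2 and every real ε > 0 there exist a real number α > 1/max(36h²/ε + 18, 8h + 1), a constant c > 0, and a threshold N₁ such that for all N ≥ N₁, the number of positive integers n < N with s_F(n^h) < ε·s_F(n) is at least c·N^α. -/

import Mathlib

/-- Zeckendorf sum of digits: number of summands in the Zeckendorf
representation of `n` (equivalently, minimal number of Fibonacci numbers
needed to write `n` as a sum of Fibonacci numbers). -/
def sF (n : ℕ) : ℕ := (Nat.zeckendorf n).length

/-- Lucas numbers: `L 0 = 2`, `L k = F (k-1) + F (k+1)` for `k ≥ 1`. -/
def lucas : ℕ → ℕ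
  | 0 => 2
  | k + 1 => Nat.fib k + Nat.fib (k + 2)

open scoped goldenRatio

/-! ### The Zeckendorf representation is the shortest one -/

/-- A potential on Fibonacci indices that decreases under every step of the reduction of a sum of
Fibonacci numbers to its Zeckendorf representation. -/
def fibWeight : ℕ → ℕ
  | 0 => 1
  | 1 => 4
  | 2 => 3
  | i + 3 => i + 5

lemma exists_zeckendorf_or_reduction (S : Multiset ℕ) :
    (∃ l : List ℕ, l.IsZeckendorfRep ∧ (l : Multiset ℕ) = S) ∨
      ∃ T : Multiset ℕ, (T.map Nat.fib).sum = (S.map Nat.fib).sum ∧ T.card ≤ S.card ∧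
        (T.map fibWeight).sum < (S.map fibWeight).sum := by
  by_cases h0 : 0 ∈ S
  · obtain ⟨T, rfl⟩ := Multiset.exists_cons_of_mem h0
    exact .inr ⟨T, by simp [fibWeight]⟩
  by_cases h1 : 1 ∈ S
  · obtain ⟨T, rfl⟩ := Multiset.exists_cons_of_mem h1
    exact .inr ⟨2 ::ₘ T, by simp [fibWeight]⟩
  by_cases hadj : ∃ i ∈ S, i + 1 ∈ S
  · obtain ⟨i, hi, hi'⟩ := hadj
    obtain ⟨T, rfl⟩ := Multiset.exists_cons_of_mem hi
    obtain ⟨U, rfl⟩ := Multiset.exists_cons_of_mem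
      ((Multiset.mem_cons.1 hi').resolve_left (by omega))
    refine .inr ⟨(i + 2) ::ₘ U, ?_, ?_, ?_⟩
    · simp [Nat.fib_add_two, add_assoc]
    · simp
    · match i, h0, h1 with
      | 0, h0, _ => simp at h0
      | 1, _, h1 => simp at h1
      | 2, _, _ => simp [fibWeight]; omega
      | i + 3, _, _ => simp [fibWeight]; omega
  by_cases hnd : S.Nodup
  · left
    refine ⟨S.sort (· ≥ ·), ?_, S.sort_eq _⟩
    have hmem : ∀ a ∈ S.sort (· ≥ ·), 2 ≤ a := by
      intro a ha
      rw [Multiset.mem_sort] at ha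
      match a, ha with
      | 0, ha => exact absurd ha h0
      | 1, ha => exact absurd ha h1
      | a + 2, _ => omega
    have hpair : (S.sort (· ≥ ·)).Pairwise fun a b ↦ b + 2 ≤ a := by
      have hsort := S.pairwise_sort (· ≥ ·)
      have hne : (S.sort (· ≥ ·)).Nodup := by
        rw [← Multiset.coe_nodup, Multiset.sort_eq]; exact hnd
      refine (hsort.and hne).imp_of_mem fun {a b} ha hb hab ↦ ?_
      rw [Multiset.mem_sort] at ha hb
      by_contra hlt
      have : a = b + 1 := by have := hab.1; have := hab.2; omega
      exact hadj ⟨b, hb, this ▸ ha⟩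
    refine List.Pairwise.isChain (List.pairwise_append.2 ⟨hpair, by simp, fun a ha b hb ↦ ?_⟩)
    have := hmem a ha
    simp at hb
    omega
  · right
    obtain ⟨i, hi⟩ : ∃ i, i ::ₘ i ::ₘ 0 ≤ S := by
      rw [Multiset.nodup_iff_le] at hnd
      push Not at hnd
      exact hnd
    obtain ⟨U, rfl⟩ := Multiset.le_iff_exists_add.1 hi
    match i, h0, h1 with
    | 0, h0, _ => simp at h0
    | 1, _, h1 => simp at h1
    | 2, _, _ => exact ⟨3 ::ₘ U, by simp [fibWeight, Nat.fib_add_two]; omega⟩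
    | 3, _, _ => exact ⟨4 ::ₘ 2 ::ₘ U, by simp [fibWeight, Nat.fib_add_two]; omega⟩
    | i + 4, _, _ =>
      refine ⟨(i + 5) ::ₘ (i + 2) ::ₘ U, ?_, by simp, ?_⟩
      · simp only [Multiset.map_cons, Multiset.sum_cons, Multiset.map_add, Multiset.sum_add,
          Multiset.map_zero, Multiset.sum_zero, Nat.fib_add_two]
        ring
      · cases i <;> simp [fibWeight] <;> omega

lemma sF_sum_fib_le_card (S : Multiset ℕ) : sF (S.map Nat.fib).sum ≤ S.card := by
  induction hw : (S.map fibWeight).sum using Nat.strong_induction_on generalizing S with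
  | _ w ih =>
    obtain ⟨l, hl, rfl⟩ | ⟨T, hsum, hcard, hlt⟩ := exists_zeckendorf_or_reduction S
    · simp [sF, Nat.zeckendorf_sum_fib hl]
    · rw [← hsum]
      exact (ih _ (hw ▸ hlt) T rfl).trans hcard

@[simp] lemma sF_zero : sF 0 = 0 := by simp [sF]

lemma sF_fib_le_one (j : ℕ) : sF (Nat.fib j) ≤ 1 := by
  simpa using sF_sum_fib_le_card {j}

lemma sF_add_le (a b : ℕ) : sF (a + b) ≤ sF a + sF b := by
  have h := sF_sum_fib_le_card ((a.zeckendorf : Multiset ℕ) + (b.zeckendorf : Multiset ℕ))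
  simpa [sF, -Multiset.coe_add] using h

lemma sF_mul_le (q x : ℕ) : sF (q * x) ≤ q * sF x := by
  induction q with
  | zero => simp
  | succ q ih => rw [add_one_mul, add_one_mul]; exact (sF_add_le _ _).trans (by gcongr)

lemma sF_sum_le {ι : Type*} (s : Finset ι) (f : ι → ℕ) :
    sF (∑ i ∈ s, f i) ≤ ∑ i ∈ s, sF (f i) :=
  Finset.le_sum_of_subadditive sF sF_zero.le sF_add_le s f

/-! ### Multiples of Fibonacci numbers -/

lemma coe_lucas (k : ℕ) : (lucas k : ℝ) = φ ^ k + ψ ^ k := by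
  cases k with
  | zero => norm_num [lucas]
  | succ k =>
    have h := Real.fib_succ_sub_goldenConj_mul_fib (k + 1)
    have h' := Real.fib_succ_sub_goldenRatio_mul_fib (k + 1)
    have e : ((Nat.fib (k + 2) : ℕ) : ℝ) = Nat.fib k + Nat.fib (k + 1) := by
      exact_mod_cast Nat.fib_add_two
    rw [lucas, Nat.cast_add, ← h, ← h', show k + 1 + 1 = k + 2 from rfl]
    linear_combination -e - (Nat.fib (k + 1) : ℝ) * Real.goldenRatio_add_goldenConj

lemma lucas_even_add_four_le (a : ℕ) : lucas (2 * a + 4) ≤ 3 * lucas (2 * a + 2) := by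
  have h1 : Nat.fib (2 * a) ≤ Nat.fib (2 * a + 1) := Nat.fib_le_fib_succ
  have h2 : Nat.fib (2 * a + 2) = Nat.fib (2 * a) + Nat.fib (2 * a + 1) := Nat.fib_add_two
  have h3 : Nat.fib (2 * a + 3) = Nat.fib (2 * a + 1) + Nat.fib (2 * a + 2) := Nat.fib_add_two
  have h4 : Nat.fib (2 * a + 4) = Nat.fib (2 * a + 2) + Nat.fib (2 * a + 3) := Nat.fib_add_two
  have h5 : Nat.fib (2 * a + 5) = Nat.fib (2 * a + 3) + Nat.fib (2 * a + 4) := Nat.fib_add_two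
  change Nat.fib (2 * a + 3) + Nat.fib (2 * a + 5) ≤
    3 * (Nat.fib (2 * a + 1) + Nat.fib (2 * a + 3))
  omega

lemma lucas_even_mul_fib (r j : ℕ) :
    lucas (2 * r) * Nat.fib (j + 2 * r) = Nat.fib (j + 4 * r) + Nat.fib j := by
  have key : (φ * ψ) ^ (2 * r) = 1 := by
    rw [Real.goldenRatio_mul_goldenConj]; simp
  have h : ((lucas (2 * r) * Nat.fib (j + 2 * r) : ℕ) : ℝ)
      = ((Nat.fib (j + 4 * r) + Nat.fib j : ℕ) : ℝ) := by
    push_cast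
    simp only [coe_lucas, Real.coe_fib_eq, pow_add, show 4 * r = 2 * r + 2 * r by ring]
    rw [mul_pow] at key
    linear_combination ((φ ^ j - ψ ^ j) / √5) * key
  exact_mod_cast h

/-- Multiplying by `d < L_{2a+2}` costs at most `4a+2` Fibonacci numbers, if multiplication by a
small even-indexed Lucas number costs at most two. -/
lemma sF_mul_le_of_lt_lucas (x a : ℕ) (hx : sF x ≤ 1)
    (hL : ∀ r, 0 < r → r ≤ a → sF (lucas (2 * r) * x) ≤ 2) (d : ℕ) (hd : d < lucas (2 * a + 2)) :
    sF (d * x) ≤ 4 * a + 2 := by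
  induction a generalizing d with
  | zero =>
    have h3 : lucas (2 * 0 + 2) = 3 := rfl
    have := sF_mul_le d x
    nlinarith
  | succ a ih =>
    set B := lucas (2 * a + 2) with hB
    have hlt : d < 3 * B := hd.trans_le (lucas_even_add_four_le a)
    have hBpos : 0 < B := by omega
    have hq : d / B < 3 := Nat.div_lt_of_lt_mul (by linarith)
    have hrem := ih (fun r h h' ↦ hL r h (by omega)) (d % B) (Nat.mod_lt _ hBpos)
    have hdec : d * x = d / B * (B * x) + d % B * x := by
      rw [← mul_assoc, ← add_mul, mul_comm _ B, Nat.div_add_mod]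
    have hBx : sF (B * x) ≤ 2 := hL (a + 1) (by omega) le_rfl
    rw [hdec]
    calc sF (d / B * (B * x) + d % B * x) ≤ d / B * sF (B * x) + sF (d % B * x) :=
          (sF_add_le _ _).trans (by gcongr; exact sF_mul_le _ _)
      _ ≤ 2 * 2 + (4 * a + 2) := by gcongr; omega
      _ = 4 * (a + 1) + 2 := by ring

lemma sF_mul_fib_le (a j d : ℕ) (hj : 2 * a ≤ j) (hd : d < lucas (2 * a + 2)) :
    sF (d * Nat.fib j) ≤ 4 * a + 2 := by
  refine sF_mul_le_of_lt_lucas _ a (sF_fib_le_one j) (fun r hr hra ↦ ?_) d hd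
  obtain ⟨i, rfl⟩ : ∃ i, j = i + 2 * r := ⟨j - 2 * r, by omega⟩
  rw [lucas_even_mul_fib r i]
  exact (sF_add_le _ _).trans (add_le_add (sF_fib_le_one _) (sF_fib_le_one _))

lemma sF_le_of_lt_lucas (a d : ℕ) (hd : d < lucas (2 * a + 2)) : sF d ≤ 4 * a + 2 := by
  have h := sF_mul_le_of_lt_lucas 1 a (sF_fib_le_one 1) (fun r hr _ ↦ ?_) d hd
  · simpa using h
  · obtain ⟨k, hk⟩ : ∃ k, 2 * r = k + 1 := ⟨2 * r - 1, by omega⟩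
    rw [mul_one, hk]
    exact (sF_add_le _ _).trans (add_le_add (sF_fib_le_one _) (sF_fib_le_one _))

/-! ### A lower bound for the number of Zeckendorf summands -/

/-- Shifting all indices of a Zeckendorf representation of length `s` by one approximates
multiplication by `φ`; the error stays away from the endpoints of its range in terms of `s`. -/
lemma shift_error_bounds (l : List ℕ) (hl : l.IsZeckendorfRep) :
    (∀ a ∈ (l ++ [0]).head?, 2 * l.length ≤ a) ∧
    -(ψ ^ 2) ≤ (l.map fun i ↦ ψ ^ i).sum - ψ ^ (2 * l.length + 2) ∧
    (l.map fun i ↦ ψ ^ i).sum ≤ -ψ + ψ ^ (2 * l.length + 1) := by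
  induction l with
  | nil => simp
  | cons a l ih =>
    have hl' := hl
    rw [List.IsZeckendorfRep, List.cons_append, List.isChain_cons] at hl'
    obtain ⟨ih0, ih1, ih2⟩ := ih hl'.2
    have hlen : 2 * l.length + 2 ≤ a := by
      cases l with
      | nil => simpa using hl'.1
      | cons b l =>
        have h1 := hl'.1 b (by simp)
        have h2 := ih0 b (by simp)
        omega
    refine ⟨by simpa [mul_add] using hlen, ?_⟩
    simp only [List.map_cons, List.sum_cons, List.length_cons]
    set S := (l.map fun i ↦ ψ ^ i).sum
    set s := l.length
    have hq : (0 : ℝ) ≤ ψ ^ 2 := sq_nonneg _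
    have hq1 : ψ ^ 2 ≤ 1 := by nlinarith [Real.neg_one_lt_goldenConj, Real.goldenConj_neg]
    have hpos : ∀ b : ℕ, 0 ≤ (ψ ^ 2) ^ b := fun b ↦ pow_nonneg hq b
    have hanti : ∀ {b c : ℕ}, b ≤ c → (ψ ^ 2) ^ c ≤ (ψ ^ 2) ^ b :=
      fun h ↦ pow_le_pow_of_le_one hq hq1 h
    have e2 : ψ ^ (2 * s + 2) = (ψ ^ 2) ^ (s + 1) := by rw [← pow_mul]; congr 1
    have e4 : ψ ^ (2 * s + 4) = (ψ ^ 2) ^ (s + 2) := by rw [← pow_mul]; congr 1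
    have e3 : ψ ^ (2 * s + 3) = ψ ^ (2 * s + 1) + ψ ^ (2 * s + 2) := by
      linear_combination ψ ^ (2 * s + 1) * Real.goldenConj_sq
    have e4' : ψ ^ (2 * s + 4) = ψ ^ (2 * s + 2) + ψ ^ (2 * s + 3) := by
      linear_combination ψ ^ (2 * s + 2) * Real.goldenConj_sq
    rw [show 2 * (s + 1) + 2 = 2 * s + 4 by ring, show 2 * (s + 1) + 1 = 2 * s + 3 by ring]
    obtain ⟨b, rfl | rfl⟩ := Nat.even_or_odd' a
    · have ea : ψ ^ (2 * b) = (ψ ^ 2) ^ b := pow_mul _ _ _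
      have h1 := hanti (show s + 1 ≤ b by omega)
      have h2 := hanti (show s + 1 ≤ s + 2 by omega)
      have h3 := hpos b
      constructor <;> linarith
    · have ea : ψ ^ (2 * b + 1) = (ψ ^ 2) ^ b * ψ := by rw [pow_succ, pow_mul]
      have ec : ψ ^ (2 * s + 3) = (ψ ^ 2) ^ (s + 1) * ψ := by rw [← pow_mul, ← pow_succ]; congr 1
      have ed : ψ ^ (2 * s + 1) = (ψ ^ 2) ^ s * ψ := by rw [pow_succ, pow_mul]
      have h1 := mul_le_mul_of_nonpos_right (hanti (show s + 1 ≤ b by omega))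
        Real.goldenConj_neg.le
      have h2 := mul_le_mul_of_nonpos_right (hanti (show s ≤ s + 1 by omega))
        Real.goldenConj_neg.le
      have h3 := mul_nonpos_of_nonneg_of_nonpos (hpos b) Real.goldenConj_neg.le
      constructor <;> linarith

lemma coe_fib_succ_sum (l : List ℕ) :
    ((l.map fun i ↦ Nat.fib (i + 1)).sum : ℝ) - φ * ((l.map Nat.fib).sum : ℕ) =
      (l.map fun i ↦ ψ ^ i).sum := by
  induction l with
  | nil => simp
  | cons a l ih =>
    simp only [List.map_cons, List.sum_cons, Nat.cast_add]
    linear_combination ih + Real.fib_succ_sub_goldenRatio_mul_fib a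

/-- If `φ (n + 1)` exceeds an integer by a small positive amount `δ`, then `n` has many summands
in its Zeckendorf representation. -/
lemma neg_goldenConj_pow_le_of_near_int (n : ℕ) (z : ℤ) (δ : ℝ) (hδ : 0 < δ) (hδ1 : δ < 1)
    (h : φ * (n + 1) = z + δ) : -ψ ^ (2 * sF n + 1) ≤ δ := by
  obtain ⟨-, h1, h2⟩ := shift_error_bounds _ (Nat.isZeckendorfRep_zeckendorf n)
  have hS := coe_fib_succ_sum n.zeckendorf
  rw [Nat.sum_zeckendorf_fib] at hS
  rw [← sF] at h1 h2
  set S := (n.zeckendorf.map fun i ↦ ψ ^ i).sum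
  have hsum := Real.goldenRatio_add_goldenConj
  have hsq := Real.goldenConj_sq
  have hp : 0 ≤ ψ ^ (2 * sF n + 2) := by
    rw [show 2 * sF n + 2 = 2 * (sF n + 1) by ring, pow_mul]; positivity
  have hn : ψ ^ (2 * sF n + 1) ≤ 0 := by
    rw [pow_succ, pow_mul]
    exact mul_nonpos_of_nonneg_of_nonpos (by positivity) Real.goldenConj_neg.le
  obtain ⟨w, hw⟩ : ∃ w : ℤ, S = w + φ - δ :=
    ⟨(n.zeckendorf.map fun i ↦ Nat.fib (i + 1)).sum - z, by
      rw [Int.cast_sub, Int.cast_natCast]; linarith⟩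
  obtain hlt | rfl | hgt := lt_trichotomy w (-1)
  · have : (w : ℝ) ≤ -2 := by exact_mod_cast (by omega : w ≤ -2)
    linarith
  · push_cast at hw
    linarith
  · have : (0 : ℝ) ≤ w := by exact_mod_cast (by omega : 0 ≤ w)
    linarith

/-! ### A polynomial with a negative coefficient whose higher powers have none -/

open Polynomial in
/-- The polynomial `m X⁴ + m X³ - X² + m X + m`. -/
noncomputable def stollPoly (m : ℕ) : ℤ[X] :=
  (m : ℤ[X]) * X ^ 4 + (m : ℤ[X]) * X ^ 3 - X ^ 2 + (m : ℤ[X]) * X + (m : ℤ[X])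

open Polynomial in
lemma exists_map_eq_stollPoly_pow (μ h : ℕ) (hh : 2 ≤ h) :
    ∃ P : ℕ[X], P.map (Nat.castRingHom ℤ) = stollPoly (μ + 3) ^ h := by
  obtain ⟨c, hc⟩ : ∃ c : ℕ[X], c.map (Nat.castRingHom ℤ) = μ := ⟨μ, by simp⟩
  have hsq : stollPoly (μ + 3) ^ 2 ∈ (mapRingHom (Nat.castRingHom ℤ)).rangeS := by
    refine ⟨(c + 3) ^ 2 * X ^ 8 + 2 * (c + 3) ^ 2 * X ^ 7 + (c + 3) * (c + 1) * X ^ 6 +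
      2 * (c + 3) * (c + 2) * X ^ 5 + (4 * (c + 3) ^ 2 + 1) * X ^ 4 +
      2 * (c + 3) * (c + 2) * X ^ 3 + (c + 3) * (c + 1) * X ^ 2 + 2 * (c + 3) ^ 2 * X +
      (c + 3) ^ 2, ?_⟩
    simp [stollPoly, hc]
    ring
  have hcube : stollPoly (μ + 3) ^ 3 ∈ (mapRingHom (Nat.castRingHom ℤ)).rangeS := by
    refine ⟨(c + 3) ^ 3 * X ^ 12 + 3 * (c + 3) ^ 3 * X ^ 11 +
      3 * (c + 3) ^ 2 * (c + 2) * X ^ 10 + 2 * (c + 3) ^ 2 * (2 * c + 3) * X ^ 9 +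
      (3 * (c + 3) ^ 2 * (3 * c + 8) + 3 * (c + 3)) * X ^ 8 +
      (3 * (c + 3) ^ 2 * (3 * c + 7) + 3 * (c + 3)) * X ^ 7 +
      (6 * (c + 3) ^ 2 * c + 6 * c ^ 2 + 36 * c + 53) * X ^ 6 +
      (3 * (c + 3) ^ 2 * (3 * c + 7) + 3 * (c + 3)) * X ^ 5 +
      (3 * (c + 3) ^ 2 * (3 * c + 8) + 3 * (c + 3)) * X ^ 4 +
      2 * (c + 3) ^ 2 * (2 * c + 3) * X ^ 3 + 3 * (c + 3) ^ 2 * (c + 2) * X ^ 2 +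
      3 * (c + 3) ^ 3 * X + (c + 3) ^ 3, ?_⟩
    simp [stollPoly, hc]
    ring
  change stollPoly (μ + 3) ^ h ∈ (mapRingHom (Nat.castRingHom ℤ)).rangeS
  obtain ⟨b, rfl | rfl⟩ := Nat.even_or_odd' h
  · rw [pow_mul]
    exact pow_mem hsq b
  · obtain ⟨c, rfl⟩ : ∃ c, b = c + 1 := ⟨b - 1, by omega⟩
    rw [show 2 * (c + 1) + 1 = 2 * c + 3 by ring, pow_add, pow_mul]
    exact mul_mem (pow_mem hsq c) hcube

open Polynomial in
lemma natDegree_stollPoly_le (m : ℕ) : (stollPoly m).natDegree ≤ 4 := by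
  unfold stollPoly
  compute_degree

open Polynomial in
/-- The powers of `stollPoly` as nonnegative combinations of monomials with small coefficients. -/
lemma exists_coeff_stollPoly_pow (m h : ℕ) (hm : 3 ≤ m) (hh : 2 ≤ h) :
    ∃ p : ℕ → ℕ, (∀ i, p i ≤ (4 * m) ^ h) ∧ ∀ x : ℝ,
      (m * x ^ 4 + m * x ^ 3 - x ^ 2 + m * x + m) ^ h =
        ∑ i ∈ Finset.range (4 * h + 1), (p i : ℝ) * x ^ i := by
  obtain ⟨μ, rfl⟩ : ∃ μ, m = μ + 3 := ⟨m - 3, by omega⟩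
  obtain ⟨P, hP⟩ := exists_map_eq_stollPoly_pow μ h hh
  have hdeg : P.natDegree < 4 * h + 1 := by
    rw [← natDegree_map_eq_of_injective (f := Nat.castRingHom ℤ) Nat.cast_injective P, hP]
    have := natDegree_pow_le_of_le h (natDegree_stollPoly_le (μ + 3))
    omega
  have heval : ∀ x : ℝ, ((μ + 3 : ℕ) * x ^ 4 + (μ + 3 : ℕ) * x ^ 3 - x ^ 2 + (μ + 3 : ℕ) * x +
      (μ + 3 : ℕ)) ^ h = ∑ i ∈ Finset.range (4 * h + 1), (P.coeff i : ℝ) * x ^ i := by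
    intro x
    have h1 := congrArg (eval₂ (Int.castRingHom ℝ) x) hP
    rw [eval₂_map, eval₂_eq_sum_range' _ hdeg, eval₂_pow] at h1
    simpa [stollPoly] using h1.symm
  refine ⟨P.coeff, fun i ↦ ?_, heval⟩
  by_cases hi : i < 4 * h + 1
  · have h1 := heval 1
    have h2 : (P.coeff i : ℝ) ≤ ∑ i ∈ Finset.range (4 * h + 1), (P.coeff i : ℝ) * 1 ^ i := by
      simp only [one_pow, mul_one]
      exact Finset.single_le_sum (f := fun i ↦ (P.coeff i : ℝ)) (fun _ _ ↦ by positivity)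
        (Finset.mem_range.2 hi)
    have h3 : (P.coeff i : ℝ) ≤ ((4 * (μ + 3)) ^ h : ℕ) := by
      rw [← h1] at h2
      refine h2.trans ?_
      push_cast
      gcongr
      · nlinarith
      · linarith
    exact_mod_cast h3
  · rw [coeff_eq_zero_of_natDegree_lt (by omega)]
    positivity

/-! ### Numbers with few-digit powers -/

/-- For even `k` this is `φ^{-2k}` times the value of `stollPoly m` at `φ^k`. -/
def stollNat (m k : ℕ) : ℕ := m * lucas (2 * k) + m * lucas k - 1

lemma lucas_pos (k : ℕ) : 0 < lucas k := by
  cases k with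
  | zero => simp [lucas]
  | succ k => have : 0 < Nat.fib (k + 2) := Nat.fib_pos.2 (by omega); simp only [lucas]; omega

lemma stollNat_add_one (m k : ℕ) (hm : 0 < m) :
    stollNat m k + 1 = m * lucas (2 * k) + m * lucas k := by
  have := Nat.mul_pos hm (lucas_pos k)
  unfold stollNat
  omega

lemma coe_stollNat (m k : ℕ) (hm : 0 < m) :
    (stollNat m k : ℝ) = m * (φ ^ (2 * k) + ψ ^ (2 * k)) + m * (φ ^ k + ψ ^ k) - 1 := by
  rw [← coe_lucas, ← coe_lucas, eq_sub_iff_add_eq]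
  exact_mod_cast stollNat_add_one m k hm

lemma goldenRatio_pow_mul_goldenConj_pow {k : ℕ} (hk : Even k) : φ ^ k * ψ ^ k = 1 := by
  rw [← mul_pow, Real.goldenRatio_mul_goldenConj, hk.neg_one_pow]

lemma goldenRatio_pow_four : φ ^ 4 = 3 * φ + 2 := by
  linear_combination (φ ^ 2 + φ + 2) * Real.goldenRatio_sq

lemma stollNat_pow_eq_sum (m k h : ℕ) (hm : 3 ≤ m) (hh : 2 ≤ h) (hk : Even k) :
    ∃ p : ℕ → ℕ, (∀ i, p i ≤ (4 * m) ^ h) ∧ stollNat m k ^ h =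
      ∑ i ∈ Finset.range (4 * h + 1), p i * Nat.fib (k * ((i : ℤ) - 2 * h) - 1).natAbs := by
  obtain ⟨p, hp, hpx⟩ := exists_coeff_stollPoly_pow m h hm hh
  refine ⟨p, hp, ?_⟩
  have key : ∀ x y : ℝ, x * y = 1 → (m * (x ^ 2 + y ^ 2) + m * (x + y) - 1) ^ h =
      ∑ i ∈ Finset.range (4 * h + 1), (p i : ℝ) * x ^ ((i : ℤ) - 2 * h) := by
    intro x y hxy
    have hx : x ≠ 0 := left_ne_zero_of_mul_eq_one hxy
    have h1 : x ^ 2 * (m * (x ^ 2 + y ^ 2) + m * (x + y) - 1) =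
        m * x ^ 4 + m * x ^ 3 - x ^ 2 + m * x + m := by
      linear_combination (m * (x * y + 1) + m * x) * hxy
    have h2 := hpx x
    rw [← h1, mul_pow] at h2
    apply mul_left_cancel₀ (pow_ne_zero h (pow_ne_zero 2 hx))
    rw [h2, Finset.mul_sum]
    refine Finset.sum_congr rfl fun i _ ↦ ?_
    rw [← pow_mul, ← zpow_natCast x (2 * h), mul_left_comm, ← zpow_add₀ hx, ← zpow_natCast x i]
    congr 2
    push_cast
    ring
  have hXY := goldenRatio_pow_mul_goldenConj_pow hk
  have hX := key _ _ hXY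
  have hY := key _ _ ((mul_comm _ _).trans hXY)
  have hn := coe_stollNat m k (by omega)
  rw [mul_comm 2 k, pow_mul, pow_mul] at hn
  rw [← hn] at hX
  rw [add_comm ((ψ ^ k) ^ 2), add_comm (ψ ^ k), ← hn] at hY
  have h5 : φ⁻¹ - ψ⁻¹ = √5 := by
    rw [Real.inv_goldenRatio, Real.inv_goldenConj, ← Real.goldenRatio_sub_goldenConj]; ring
  have hfib : ∀ i : ℕ, ((Nat.fib (k * ((i : ℤ) - 2 * h) - 1).natAbs : ℕ) : ℝ) =
      ((φ ^ k) ^ ((i : ℤ) - 2 * h) * φ⁻¹ - (ψ ^ k) ^ ((i : ℤ) - 2 * h) * ψ⁻¹) / √5 := by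
    intro i
    have hodd : Odd ((k : ℤ) * ((i : ℤ) - 2 * h) - 1) :=
      (((Int.even_coe_nat k).2 hk).mul_right _).sub_odd odd_one
    have h6 := Real.coe_intFib_eq (k * ((i : ℤ) - 2 * h) - 1)
    rw [Int.fib_of_odd hodd] at h6
    rw [← zpow_natCast φ k, ← zpow_natCast ψ k, ← zpow_mul, ← zpow_mul,
      ← zpow_sub_one₀ Real.goldenRatio_ne_zero, ← zpow_sub_one₀ Real.goldenConj_ne_zero]
    exact_mod_cast h6
  have hmain : ((stollNat m k : ℝ)) ^ h = ∑ i ∈ Finset.range (4 * h + 1),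
      (p i : ℝ) * (Nat.fib (k * ((i : ℤ) - 2 * h) - 1).natAbs : ℕ) := by
    have h5' : √5 ≠ 0 := by positivity
    apply mul_right_cancel₀ h5'
    calc ((stollNat m k : ℝ)) ^ h * √5
        = (stollNat m k : ℝ) ^ h * φ⁻¹ - (stollNat m k : ℝ) ^ h * ψ⁻¹ := by rw [← h5]; ring
      _ = _ := by
        nth_rewrite 1 [hX]
        rw [hY, Finset.sum_mul, Finset.sum_mul, Finset.sum_mul, ← Finset.sum_sub_distrib]
        refine Finset.sum_congr rfl fun i _ ↦ ?_
        rw [hfib]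
        field_simp
  exact_mod_cast hmain

lemma sF_stollNat_pow_le (m k h a : ℕ) (hm : 3 ≤ m) (hh : 2 ≤ h) (hk : Even k)
    (ha : (4 * m) ^ h < lucas (2 * a + 2)) (hka : 2 * a + 1 ≤ k) :
    sF (stollNat m k ^ h) ≤ (4 * h + 1) * (4 * a + 2) := by
  obtain ⟨p, hp, hsum⟩ := stollNat_pow_eq_sum m k h hm hh hk
  rw [hsum]
  refine (sF_sum_le _ _).trans ((Finset.sum_le_card_nsmul _ _ (4 * a + 2) fun i _ ↦ ?_).trans
    (by simp))
  have hpi := (hp i).trans_lt ha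
  obtain heq | hne := eq_or_ne ((i : ℤ) - 2 * h) 0
  · rw [heq]
    simpa using sF_le_of_lt_lucas a (p i) hpi
  · refine sF_mul_fib_le a _ _ ?_ hpi
    have h1 : (k : ℤ) ≤ |(k : ℤ) * ((i : ℤ) - 2 * h)| := by
      rw [abs_mul, Nat.abs_cast]
      exact le_mul_of_one_le_right (by positivity) (Int.one_le_abs hne)
    rcases le_abs.1 h1 with h1 | h1 <;> omega

lemma le_two_mul_sF_stollNat (m k u : ℕ) (hm : 0 < m) (hk : Even k) (hu : (m : ℝ) ≤ φ ^ u) :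
    k ≤ 2 * sF (stollNat m k) + u + 5 := by
  by_contra! hlt
  have hψ : 0 ≤ ψ ^ k := hk.pow_nonneg _
  have hXY := goldenRatio_pow_mul_goldenConj_pow hk
  have hφ1 := Real.one_lt_goldenRatio
  have hsum := Real.goldenRatio_add_goldenConj
  have hψ1 : ψ ^ k ≤ 1 := by
    rw [← hXY]
    exact le_mul_of_one_le_left hψ (one_le_pow₀ hφ1.le)
  set s := sF (stollNat m k) with hs
  set δ : ℝ := m * √5 * (ψ ^ (2 * k) + ψ ^ k) with hδ
  have hm' : (0 : ℝ) < m := by exact_mod_cast hm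
  have hψpos : 0 < ψ ^ k := by
    rcases hψ.lt_or_eq with h | h
    · exact h
    · rw [← h] at hXY; simp at hXY
  have hδ0 : 0 < δ := by
    rw [hδ, mul_comm 2 k, pow_mul]; positivity
  have h4 : 2 * √5 < φ ^ 4 := by
    rw [goldenRatio_pow_four, ← Real.goldenRatio_sub_goldenConj]
    linarith [Real.goldenRatio_lt_two]
  have hδφ : δ * φ ^ (2 * s + 1) < 1 := by
    have h1 : ψ ^ (2 * k) + ψ ^ k ≤ 2 * ψ ^ k := by
      rw [mul_comm 2 k, pow_mul]; nlinarith
    have h2 : φ ^ u * φ ^ 4 * φ ^ (2 * s + 1) ≤ φ ^ k := by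
      rw [← pow_add, ← pow_add]
      exact pow_le_pow_right₀ hφ1.le (by omega)
    calc δ * φ ^ (2 * s + 1) ≤ φ ^ u * √5 * (2 * ψ ^ k) * φ ^ (2 * s + 1) := by
          have h0 : 0 ≤ ψ ^ (2 * k) + ψ ^ k := by rw [mul_comm 2 k, pow_mul]; positivity
          rw [hδ]; gcongr
      _ = (2 * √5) * (φ ^ u * φ ^ (2 * s + 1) * ψ ^ k) := by ring
      _ < φ ^ 4 * (φ ^ u * φ ^ (2 * s + 1) * ψ ^ k) := by gcongr
      _ = (φ ^ u * φ ^ 4 * φ ^ (2 * s + 1)) * ψ ^ k := by ring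
      _ ≤ φ ^ k * ψ ^ k := by gcongr
      _ = 1 := hXY
  have hφs : 1 ≤ φ ^ (2 * s + 1) := one_le_pow₀ hφ1.le
  have hnear : φ * ((stollNat m k : ℝ) + 1) =
      ((m * (lucas (2 * k + 1) + lucas (k + 1)) : ℕ) : ℤ) + δ := by
    rw [coe_stollNat m k hm, hδ, ← Real.goldenRatio_sub_goldenConj]
    push_cast
    rw [coe_lucas, coe_lucas]
    ring
  have hlow := neg_goldenConj_pow_le_of_near_int _ _ δ hδ0 (by nlinarith) hnear
  rw [← hs] at hlow
  have hprod : -ψ ^ (2 * s + 1) * φ ^ (2 * s + 1) = 1 := by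
    rw [neg_mul, ← mul_pow, Real.goldenConj_mul_goldenRatio, pow_succ, pow_mul]; norm_num
  nlinarith

/-! ### Counting -/

lemma lucas_even_gt (j : ℕ) : φ ^ (2 * j) < lucas (2 * j) := by
  rw [coe_lucas, pow_mul ψ]
  have := pow_pos (pow_pos (neg_pos.2 Real.goldenConj_neg) 2) j
  rw [neg_sq] at this
  linarith

lemma four_le_goldenRatio_pow_four : 4 ≤ φ ^ 4 := by
  rw [goldenRatio_pow_four]; linarith [Real.one_lt_goldenRatio]

lemma sF_stollNat_pow_lt (h : ℕ) (hh : 2 ≤ h) (ε : ℝ) (hε : 0 < ε) (v k m : ℕ) (hk : Even k)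
    (hm : 3 ≤ m) (hmv : (m : ℝ) ≤ φ ^ (2 * v)) (hk1 : 2 * (h : ℝ) * v + (4 * h + 1) ≤ k)
    (hk2 : ((32 * (h : ℝ) ^ 2 + 8 * h) / ε + 2) * v + ((4 * h + 1) * (16 * h + 4) / ε + 6) ≤ k) :
    (sF (stollNat m k ^ h) : ℝ) < ε * sF (stollNat m k) := by
  have hlt : (4 * m) ^ h < lucas (2 * (h * (v + 2)) + 2) := by
    have h1 : ((4 * m : ℕ) : ℝ) ≤ φ ^ 4 * φ ^ (2 * v) := by
      push_cast
      exact mul_le_mul four_le_goldenRatio_pow_four hmv (by positivity)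
        (by have := Real.goldenRatio_pos; positivity)
    have h2 : (((4 * m) ^ h : ℕ) : ℝ) ≤ φ ^ (2 * (h * (v + 2))) := by
      calc (((4 * m) ^ h : ℕ) : ℝ) = ((4 * m : ℕ) : ℝ) ^ h := by push_cast; rfl
        _ ≤ (φ ^ 4 * φ ^ (2 * v)) ^ h := by gcongr
        _ = φ ^ (2 * (h * (v + 2))) := by rw [← pow_add, ← pow_mul]; congr 1; ring
    have h3 : φ ^ (2 * (h * (v + 2))) ≤ φ ^ (2 * (h * (v + 2) + 1)) :=
      pow_le_pow_right₀ Real.one_lt_goldenRatio.le (by omega)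
    exact_mod_cast h2.trans_lt (h3.trans_lt (lucas_even_gt (h * (v + 2) + 1)))
  have hka : 2 * (h * (v + 2)) + 1 ≤ k := by
    have : ((2 * (h * (v + 2)) + 1 : ℕ) : ℝ) ≤ k := by push_cast; linarith
    exact_mod_cast this
  have hup : (sF (stollNat m k ^ h) : ℝ) ≤ (4 * h + 1) * (4 * (h * (v + 2)) + 2) := by
    exact_mod_cast sF_stollNat_pow_le m k h _ hm hh hk hlt hka
  have hlow : (k : ℝ) ≤ 2 * sF (stollNat m k) + 2 * v + 5 := by
    exact_mod_cast le_two_mul_sF_stollNat m k (2 * v) (by omega) hk hmv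
  have h1 : (32 * (h : ℝ) ^ 2 + 8 * h) / ε * v + (4 * h + 1) * (16 * h + 4) / ε <
      2 * sF (stollNat m k) := by linarith
  have h2 : (32 * (h : ℝ) ^ 2 + 8 * h) / ε * v + (4 * h + 1) * (16 * h + 4) / ε =
      2 * ((4 * h + 1) * (4 * (h * (v + 2)) + 2)) / ε := by
    field_simp
    ring
  rw [h2, div_lt_iff₀ hε] at h1
  linarith

lemma stollNat_lt_pow (m k v : ℕ) (hm : 0 < m) (hk : Even k) (hmv : (m : ℝ) ≤ φ ^ (2 * v)) :
    (stollNat m k : ℝ) < φ ^ (2 * v + 2 * k + 4) := by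
  have h1 : φ ^ k ≤ φ ^ (2 * k) := pow_le_pow_right₀ Real.one_lt_goldenRatio.le (by omega)
  have h2 : (1 : ℝ) ≤ φ ^ (2 * k) := one_le_pow₀ Real.one_lt_goldenRatio.le
  have hψ : ∀ j, Even j → ψ ^ j ≤ 1 := fun j hj ↦ by
    rw [← goldenRatio_pow_mul_goldenConj_pow hj]
    exact le_mul_of_one_le_left (hj.pow_nonneg _) (one_le_pow₀ Real.one_lt_goldenRatio.le)
  have h3 := hψ k hk
  have h4 := hψ (2 * k) (even_two_mul k)
  have hφ := Real.goldenRatio_pos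
  rw [coe_stollNat m k hm]
  calc m * (φ ^ (2 * k) + ψ ^ (2 * k)) + m * (φ ^ k + ψ ^ k) - 1
      < m * ((φ ^ (2 * k) + ψ ^ (2 * k)) + (φ ^ k + ψ ^ k)) := by linarith
    _ ≤ m * (4 * φ ^ (2 * k)) := by gcongr; linarith
    _ ≤ φ ^ (2 * v) * (φ ^ 4 * φ ^ (2 * k)) := by
      gcongr; exact four_le_goldenRatio_pow_four
    _ = φ ^ (2 * v + 2 * k + 4) := by ring

lemma stollNat_add_three_injective (k : ℕ) : Function.Injective fun μ ↦ stollNat (μ + 3) k := by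
  intro a b hab
  have ha := stollNat_add_one (a + 3) k (by omega)
  have hb := stollNat_add_one (b + 3) k (by omega)
  dsimp only at hab
  rw [hab, hb, ← mul_add, ← mul_add] at ha
  have := Nat.eq_of_mul_eq_mul_right (Nat.add_pos_right _ (lucas_pos k)) ha
  omega

lemma le_ncard_of_stollNat_mem (S : Set ℕ) (hS : S.Finite) (k M : ℕ)
    (hM : ∀ μ < M, stollNat (μ + 3) k ∈ S) : M ≤ S.ncard := by
  classical
  calc M = ((Finset.range M).image fun μ ↦ stollNat (μ + 3) k).card := by
        rw [Finset.card_image_of_injective _ (stollNat_add_three_injective k), Finset.card_range]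
    _ ≤ S.ncard := by
        rw [← Set.ncard_coe_finset]
        refine Set.ncard_le_ncard (fun x hx ↦ ?_) hS
        simp only [Finset.coe_image, Set.mem_image, Finset.coe_range, Set.mem_Iio] at hx
        obtain ⟨μ, hμ, rfl⟩ := hx
        exact hM μ hμ

lemma stollNat_pos (m k : ℕ) (hm : 3 ≤ m) : 0 < stollNat m k := by
  have h1 := stollNat_add_one m k (by omega)
  have h2 := Nat.mul_le_mul hm (lucas_pos k)
  omega

lemma le_ncard_of_pow_le (h : ℕ) (hh : 2 ≤ h) (ε : ℝ) (hε : 0 < ε) (v k N : ℕ) (hk : Even k)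
    (hv : 2 ≤ v) (hk1 : 2 * (h : ℝ) * v + (4 * h + 1) ≤ k)
    (hk2 : ((32 * (h : ℝ) ^ 2 + 8 * h) / ε + 2) * v + ((4 * h + 1) * (16 * h + 4) / ε + 6) ≤ k)
    (hN : φ ^ (2 * v + 2 * k + 4) ≤ N) :
    φ ^ (2 * v) / 10 ≤
      (Set.ncard {n : ℕ | 0 < n ∧ n < N ∧ (sF (n ^ h) : ℝ) < ε * sF n} : ℝ) := by
  have hφ := Real.goldenRatio_pos
  have hcard := le_ncard_of_stollNat_mem {n : ℕ | 0 < n ∧ n < N ∧ (sF (n ^ h) : ℝ) < ε * sF n}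
    ((Set.finite_Iio N).subset fun n hn ↦ hn.2.1) k (⌊φ ^ (2 * v)⌋₊ - 3) fun μ hμ ↦ by
      have hmv : ((μ + 3 : ℕ) : ℝ) ≤ φ ^ (2 * v) :=
        (Nat.le_floor_iff (by positivity)).1 (by omega)
      refine ⟨stollNat_pos _ _ (by omega), ?_,
        sF_stollNat_pow_lt h hh ε hε v k _ hk (by omega) hmv hk1 hk2⟩
      exact_mod_cast (stollNat_lt_pow _ k v (by omega) hk hmv).trans_le hN
  have h1 : (⌊φ ^ (2 * v)⌋₊ : ℝ) ≤
      (Set.ncard {n : ℕ | 0 < n ∧ n < N ∧ (sF (n ^ h) : ℝ) < ε * sF n} : ℝ) + 3 := by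
    exact_mod_cast Nat.sub_le_iff_le_add.1 hcard
  have h2 := Nat.lt_floor_add_one (φ ^ (2 * v))
  have h3 : φ ^ 4 ≤ φ ^ (2 * v) := pow_le_pow_right₀ Real.one_lt_goldenRatio.le (by omega)
  have h4 : (3 / 2 : ℝ) ≤ φ := by nlinarith [Real.goldenRatio_sq]
  rw [goldenRatio_pow_four] at h3
  linarith

theorem stmt_4 (h : ℕ) (hh : 2 ≤ h) (ε : ℝ) (hε : 0 < ε) :
    ∃ α : ℝ, α > 1 / max (36 * (h : ℝ) ^ 2 / ε + 18) (8 * (h : ℝ) + 1) ∧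
      ∃ c : ℝ, 0 < c ∧ ∃ N₁ : ℕ, ∀ N : ℕ, N₁ ≤ N →
        c * (N : ℝ) ^ α ≤
          (Set.ncard {n : ℕ | 0 < n ∧ n < N ∧ (sF (n ^ h) : ℝ) < ε * sF n} : ℝ) := by
  have hφ := Real.goldenRatio_pos
  have hφ1 := Real.one_lt_goldenRatio
  have hh' : (2 : ℝ) ≤ h := by exact_mod_cast hh
  set K : ℝ := max ((32 * (h : ℝ) ^ 2 + 8 * h) / ε + 2) (2 * h) with hK
  set D : ℝ := 4 * h + 1 + ((4 * h + 1) * (16 * h + 4) / ε + 6) with hD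
  have hK1 : (32 * (h : ℝ) ^ 2 + 8 * h) / ε + 2 ≤ K := le_max_left _ _
  have hK2 : 2 * (h : ℝ) ≤ K := le_max_right _ _
  have hK0 : 0 < 1 + K := by linarith
  have hD1 : 0 ≤ (4 * (h : ℝ) + 1) * (16 * h + 4) / ε := by positivity
  set E : ℝ := 2 * D + 8 with hE
  set B : ℝ := φ ^ (2 * (1 + K)) with hB
  have hB1 : 1 < B := Real.one_lt_rpow hφ1 (by positivity)
  have hE0 : 0 < φ ^ E := Real.rpow_pos_of_pos hφ _
  refine ⟨1 / (1 + K), ?_, (φ ^ (E / (1 + K) + 2) * 10)⁻¹, by positivity, ⌈B ^ 2 * φ ^ E⌉₊,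
    fun N hN ↦ ?_⟩
  · refine one_div_lt_one_div_of_lt hK0 ?_
    rw [hK, ← max_add_add_left]
    refine max_lt_max ?_ (by linarith)
    have : (32 * (h : ℝ) ^ 2 + 8 * h) / ε ≤ 36 * (h : ℝ) ^ 2 / ε := by gcongr; nlinarith
    linarith
  · have hNx : B ^ 2 ≤ N / φ ^ E := (le_div_iff₀ hE0).2 (Nat.ceil_le.1 hN)
    obtain ⟨v, hv1, hv2⟩ := exists_nat_pow_near ((one_le_pow₀ hB1.le).trans hNx) hB1
    have hv : 2 ≤ v := by
      have := (pow_lt_pow_iff_right₀ hB1).1 (hNx.trans_lt hv2)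
      omega
    rw [le_div_iff₀ hE0] at hv1
    rw [div_lt_iff₀ hE0] at hv2
    have hBpow : ∀ j : ℕ, B ^ j * φ ^ E = φ ^ (2 * (1 + K) * j + E) := fun j ↦ by
      rw [hB, ← Real.rpow_mul_natCast hφ.le, ← Real.rpow_add hφ]
    rw [hBpow] at hv1 hv2
    set k := 2 * ⌈(K * v + D) / 2⌉₊ with hk
    have hkv : 0 ≤ K * v + D := by positivity
    have hklow : K * v + D ≤ k := by
      have := Nat.le_ceil ((K * v + D) / 2)
      rw [hk]; push_cast; linarith
    have hkup : (k : ℝ) ≤ K * v + D + 2 := by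
      have := Nat.ceil_lt_add_one (div_nonneg hkv zero_le_two)
      rw [hk]; push_cast; linarith
    have hv0 : (0 : ℝ) ≤ v := by positivity
    have hmul1 := mul_le_mul_of_nonneg_right hK1 hv0
    have hmul2 := mul_le_mul_of_nonneg_right hK2 hv0
    have hNbig : φ ^ (2 * v + 2 * k + 4) ≤ (N : ℝ) := by
      refine le_trans ?_ hv1
      rw [← Real.rpow_natCast]
      refine Real.rpow_le_rpow_of_exponent_le hφ1.le ?_
      push_cast
      linarith
    refine le_trans ?_ (le_ncard_of_pow_le h hh ε hε v k N (even_two_mul _) hv (by linarith)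
      (by linarith) hNbig)
    have hNα : (N : ℝ) ^ (1 / (1 + K)) ≤ φ ^ (E / (1 + K) + 2) * φ ^ (2 * v) := by
      calc (N : ℝ) ^ (1 / (1 + K)) ≤ (φ ^ (2 * (1 + K) * (v + 1 : ℕ) + E)) ^ (1 / (1 + K)) := by
            gcongr
        _ = φ ^ (E / (1 + K) + 2) * φ ^ (2 * v) := by
            rw [← Real.rpow_mul hφ.le, ← Real.rpow_natCast φ (2 * v), ← Real.rpow_add hφ]
            congr 1
            push_cast
            field_simp
            ring
    rw [inv_mul_le_iff₀ (by positivity)]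
    linarith
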